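/- Let G be the 5-dimensional Lie group whose Lie algebra has an orthonormal basis {e₀,…,e₄} with brackets [e₀,e₁] = pe₂ − e₃ + qe₄, [e₀,e₂] = −pe₁ − qe₃ − e₄, [e₀,e₃] = −e₁ + qe₂ + pe₄, [e₀,e₄] = −qe₁ − e₂ − pe₃ (p,q ∈ ℝ, all other brackets zero), endowed with the apapR structure ξ = e₀, φe₁ = e₃, φe₂ = e₄, φe₃ = e₁, φe₄ = e₂, and the left-invariant metric g making the basis orthonormal. With the generalized symmetric metric connection ∇̄ (α, β constant), the nonzero Ricci components are R̄ic₀₀ = 4(β−1), R̄ic₁₁ = R̄ic₂₂ = R̄ic₃₃ = R̄ic₄₄ = β² − β − 3α², R̄ic₁₃ = R̄ic₂₄ = 3α − 2αβ, and the scalar curvature is scal̄ = 4(β² − 3α² − 1). -/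

import Mathlib

/-!
Concrete model of the 5-dimensional Lie group `G` of Example 2: left-invariant
vector fields are identified with `Fin 5 → ℝ` via the orthonormal basis
`{e₀,…,e₄}` with brackets
`[e₀,e₁] = pe₂ − e₃ + qe₄`, `[e₀,e₂] = −pe₁ − qe₃ − e₄`,
`[e₀,e₃] = −e₁ + qe₂ + pe₄`, `[e₀,e₄] = −qe₁ − e₂ − pe₃` (others zero),
and the apapR structure `ξ = e₀`, `φe₁ = e₃`, `φe₂ = e₄`, `φe₃ = e₁`,
`φe₄ = e₂`, `η(x) = x₀`, `g` the dot product.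
-/

/-- The orthonormal basis `e₀, …, e₄`. -/
def e5 (i : Fin 5) : Fin 5 → ℝ := fun j => if i = j then 1 else 0

/-- The left-invariant metric (dot product in the orthonormal basis). -/
def g5 (x y : Fin 5 → ℝ) : ℝ := ∑ i, x i * y i

/-- The Lie bracket determined by the structure constants above. -/
def br5 (p q : ℝ) (x y : Fin 5 → ℝ) : Fin 5 → ℝ :=
  ![0,
    -p * (x 0 * y 2 - x 2 * y 0) - (x 0 * y 3 - x 3 * y 0)
      - q * (x 0 * y 4 - x 4 * y 0),
    p * (x 0 * y 1 - x 1 * y 0) + q * (x 0 * y 3 - x 3 * y 0)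
      - (x 0 * y 4 - x 4 * y 0),
    -(x 0 * y 1 - x 1 * y 0) - q * (x 0 * y 2 - x 2 * y 0)
      - p * (x 0 * y 4 - x 4 * y 0),
    q * (x 0 * y 1 - x 1 * y 0) - (x 0 * y 2 - x 2 * y 0)
      + p * (x 0 * y 3 - x 3 * y 0)]

/-- The paracontact endomorphism: `φe₀ = 0`, `φe₁ = e₃`, `φe₂ = e₄`,
`φe₃ = e₁`, `φe₄ = e₂`. -/
def phi5 (x : Fin 5 → ℝ) : Fin 5 → ℝ := ![0, x 3, x 4, x 1, x 2]

/-- The Reeb vector field `ξ = e₀`. -/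
def xi5 : Fin 5 → ℝ := ![1, 0, 0, 0, 0]

/-- The contact form `η(x) = g(x, ξ) = x₀`. -/
def eta5 (x : Fin 5 → ℝ) : ℝ := x 0

/-- The Levi-Civita connection: nonzero components
`∇_{e₀}e₁ = pe₂ + qe₄`, `∇_{e₁}e₀ = e₃`, `∇_{e₀}e₂ = −pe₁ − qe₃`,
`∇_{e₂}e₀ = e₄`, `∇_{e₀}e₃ = qe₂ + pe₄`, `∇_{e₃}e₀ = e₁`,
`∇_{e₀}e₄ = −qe₁ − pe₃`, `∇_{e₄}e₀ = e₂`,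
`∇_{e₁}e₃ = ∇_{e₂}e₄ = ∇_{e₃}e₁ = ∇_{e₄}e₂ = −e₀`. -/
def nab5 (p q : ℝ) (x y : Fin 5 → ℝ) : Fin 5 → ℝ :=
  ![-(x 1 * y 3 + x 2 * y 4 + x 3 * y 1 + x 4 * y 2),
    x 0 * (-p * y 2 - q * y 4) + y 0 * x 3,
    x 0 * (p * y 1 + q * y 3) + y 0 * x 4,
    x 0 * (-q * y 2 - p * y 4) + y 0 * x 1,
    x 0 * (q * y 1 + p * y 3) + y 0 * x 2]

/-- The generalized symmetric metric connection
`∇̄_x y = ∇_x y + α{g(x,y)ξ − η(y)x} + β{g(φx,y)ξ − η(y)φx}`. -/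
def bar5 (p q α β : ℝ) (x y : Fin 5 → ℝ) : Fin 5 → ℝ :=
  nab5 p q x y + (α * g5 x y) • xi5 - (α * eta5 y) • x
    + (β * g5 (phi5 x) y) • xi5 - (β * eta5 y) • phi5 x

/-- The curvature tensor of `∇̄`:
`R̄(x,y)z = ∇̄_x∇̄_y z − ∇̄_y∇̄_x z − ∇̄_{[x,y]}z`. -/
def curv5 (p q α β : ℝ) (x y z : Fin 5 → ℝ) : Fin 5 → ℝ :=
  bar5 p q α β x (bar5 p q α β y z) - bar5 p q α β y (bar5 p q α β x z)
    - bar5 p q α β (br5 p q x y) z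

/-- The Ricci tensor of `∇̄`: `R̄ic(x,y) = Σ_{i=0}^{4} g(R̄(e_i,x)y, e_i)`. -/
def Ric5 (p q α β : ℝ) (x y : Fin 5 → ℝ) : ℝ :=
  ∑ i, g5 (curv5 p q α β (e5 i) x y) (e5 i)

/-- The scalar curvature of `∇̄`. -/
def scal5 (p q α β : ℝ) : ℝ := ∑ i, Ric5 p q α β (e5 i) (e5 i)

/-- The associated metric `g̃(x,y) = g(x,φy) + η(x)η(y)`. -/
def tg5 (x y : Fin 5 → ℝ) : ℝ := g5 x (phi5 y) + eta5 x * eta5 y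

theorem bar5_eq (p q α β : ℝ) (x y : Fin 5 → ℝ) : bar5 p q α β x y =
    ![-(x 1 * y 3 + x 2 * y 4 + x 3 * y 1 + x 4 * y 2)
        + α * (x 1 * y 1 + x 2 * y 2 + x 3 * y 3 + x 4 * y 4)
        + β * (x 3 * y 1 + x 4 * y 2 + x 1 * y 3 + x 2 * y 4),
      x 0 * (-p * y 2 - q * y 4) + y 0 * x 3 - α * y 0 * x 1 - β * y 0 * x 3,
      x 0 * (p * y 1 + q * y 3) + y 0 * x 4 - α * y 0 * x 2 - β * y 0 * x 4,
      x 0 * (-q * y 2 - p * y 4) + y 0 * x 1 - α * y 0 * x 3 - β * y 0 * x 1,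
      x 0 * (q * y 1 + p * y 3) + y 0 * x 2 - α * y 0 * x 4 - β * y 0 * x 2] := by
  ext i
  fin_cases i <;> simp [bar5, nab5, g5, phi5, xi5, eta5, Fin.sum_univ_five, Matrix.vecHead, Matrix.vecTail] <;> ring

theorem e5_0 : e5 0 = ![1, 0, 0, 0, 0] := by ext i; fin_cases i <;> simp [e5]
theorem e5_1 : e5 1 = ![0, 1, 0, 0, 0] := by ext i; fin_cases i <;> simp [e5]
theorem e5_2 : e5 2 = ![0, 0, 1, 0, 0] := by ext i; fin_cases i <;> simp [e5]
theorem e5_3 : e5 3 = ![0, 0, 0, 1, 0] := by ext i; fin_cases i <;> simp [e5]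
theorem e5_4 : e5 4 = ![0, 0, 0, 0, 1] := by ext i; fin_cases i <;> simp [e5]

theorem Ric5_eq (p q α β : ℝ) (x y : Fin 5 → ℝ) : Ric5 p q α β x y =
    curv5 p q α β (e5 0) x y 0 + curv5 p q α β (e5 1) x y 1 + curv5 p q α β (e5 2) x y 2
    + curv5 p q α β (e5 3) x y 3 + curv5 p q α β (e5 4) x y 4 := by
  simp [Ric5, g5, e5, Fin.sum_univ_five]

/-- on the 5-dimensional example `G`, the nonzero Ricci
components of the generalized symmetric metric connection are
`R̄ic₀₀ = 4(β−1)`, `R̄ic₁₁ = R̄ic₂₂ = R̄ic₃₃ = R̄ic₄₄ = β² − β − 3α²`,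
`R̄ic₁₃ = R̄ic₂₄ = 3α − 2αβ`, and the scalar curvature is
`scal̄ = 4(β² − 3α² − 1)`. -/
theorem example2_ricci_scal (p q α β : ℝ) :
    (Ric5 p q α β (e5 0) (e5 0) = 4 * (β - 1)) ∧
    (Ric5 p q α β (e5 1) (e5 1) = β ^ 2 - β - 3 * α ^ 2) ∧
    (Ric5 p q α β (e5 2) (e5 2) = β ^ 2 - β - 3 * α ^ 2) ∧
    (Ric5 p q α β (e5 3) (e5 3) = β ^ 2 - β - 3 * α ^ 2) ∧
    (Ric5 p q α β (e5 4) (e5 4) = β ^ 2 - β - 3 * α ^ 2) ∧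
    (Ric5 p q α β (e5 1) (e5 3) = 3 * α - 2 * α * β) ∧
    (Ric5 p q α β (e5 2) (e5 4) = 3 * α - 2 * α * β) ∧
    (scal5 p q α β = 4 * (β ^ 2 - 3 * α ^ 2 - 1)) := by
  have h00 : Ric5 p q α β (e5 0) (e5 0) = 4 * (β - 1) := by
    simp [Ric5_eq, curv5, bar5_eq, br5, e5_0, e5_1, e5_2, e5_3, e5_4] <;> ring
  have h11 : Ric5 p q α β (e5 1) (e5 1) = β ^ 2 - β - 3 * α ^ 2 := by
    simp [Ric5_eq, curv5, bar5_eq, br5, e5_0, e5_1, e5_2, e5_3, e5_4] <;> ring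
  have h22 : Ric5 p q α β (e5 2) (e5 2) = β ^ 2 - β - 3 * α ^ 2 := by
    simp [Ric5_eq, curv5, bar5_eq, br5, e5_0, e5_1, e5_2, e5_3, e5_4] <;> ring
  have h33 : Ric5 p q α β (e5 3) (e5 3) = β ^ 2 - β - 3 * α ^ 2 := by
    simp [Ric5_eq, curv5, bar5_eq, br5, e5_0, e5_1, e5_2, e5_3, e5_4] <;> ring
  have h44 : Ric5 p q α β (e5 4) (e5 4) = β ^ 2 - β - 3 * α ^ 2 := by
    simp [Ric5_eq, curv5, bar5_eq, br5, e5_0, e5_1, e5_2, e5_3, e5_4] <;> ring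
  have h13 : Ric5 p q α β (e5 1) (e5 3) = 3 * α - 2 * α * β := by
    simp [Ric5_eq, curv5, bar5_eq, br5, e5_0, e5_1, e5_2, e5_3, e5_4] <;> ring
  have h24 : Ric5 p q α β (e5 2) (e5 4) = 3 * α - 2 * α * β := by
    simp [Ric5_eq, curv5, bar5_eq, br5, e5_0, e5_1, e5_2, e5_3, e5_4] <;> ring
  refine ⟨h00, h11, h22, h33, h44, h13, h24, ?_⟩
  rw [scal5, Fin.sum_univ_five, h00, h11, h22, h33, h44]
  ring
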